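/- For every L-convex space X, the L-convex space X^F — the F-closure of Θ(X) = {co(1_x) | x ∈ X} inside Cp(C(X)), equipped with the L-convex structure {φ(A)|_{X^F} | A ∈ C(X)} where φ(A)(K) = sub(K,A) — is sober. -/

import Mathlib

universe u v w u'

/-- A complete residuated lattice: a complete lattice with a commutative monoid
operation `tens` whose unit is the top element and which distributes over
arbitrary joins; `himp` is its residuation. -/
class CRL (L : Type u) extends CompleteLattice L where
  tens : L → L → L
  himp : L → L → L
  tens_comm : ∀ a b : L, tens a b = tens b a
  tens_assoc : ∀ a b c : L, tens (tens a b) c = tens a (tens b c)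
  tens_top : ∀ a : L, tens a ⊤ = a
  tens_sSup : ∀ (a : L) (S : Set L), tens a (sSup S) = ⨆ b ∈ S, tens a b
  tens_le_iff_le_himp : ∀ a b c : L, tens a b ≤ c ↔ a ≤ himp b c

namespace CRL

variable {L : Type u} [CRL L]

lemma le_himp_iff {a b c : L} : a ≤ himp b c ↔ tens a b ≤ c :=
  (tens_le_iff_le_himp a b c).symm

lemma tens_himp_le (b c : L) : tens (himp b c) b ≤ c := le_himp_iff.mp le_rfl

lemma tens_mono_right (a : L) {b c : L} (h : b ≤ c) : tens a b ≤ tens a c := by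
  have h1 : sSup ({b, c} : Set L) = c := by
    apply le_antisymm (sSup_le ?_) (le_sSup (by simp))
    rintro x (rfl | rfl)
    · exact h
    · exact le_rfl
  have h2 : tens a b ≤ ⨆ x ∈ ({b, c} : Set L), tens a x :=
    le_biSup _ (by simp)
  calc tens a b ≤ ⨆ x ∈ ({b, c} : Set L), tens a x := h2
    _ = tens a (sSup {b, c}) := (tens_sSup a _).symm
    _ = tens a c := by rw [h1]

lemma tens_mono_left {a b : L} (c : L) (h : a ≤ b) : tens a c ≤ tens b c := by
  rw [tens_comm a c, tens_comm b c]; exact tens_mono_right c h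

lemma himp_le_himp_right (a : L) {b c : L} (h : b ≤ c) : himp a b ≤ himp a c :=
  le_himp_iff.mpr (le_trans (tens_himp_le a b) h)

lemma himp_le_himp_left {a b : L} (c : L) (h : a ≤ b) : himp b c ≤ himp a c :=
  le_himp_iff.mpr (le_trans (tens_mono_right _ h) (tens_himp_le b c))

lemma tens_bot (a : L) : tens a ⊥ = ⊥ := by
  have := tens_sSup a ∅
  simpa using this

lemma top_himp (a : L) : himp ⊤ a = a := by
  apply le_antisymm
  · have := tens_himp_le (⊤ : L) a
    rwa [tens_top] at this
  · exact le_himp_iff.mpr (by rw [tens_top])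

lemma bot_himp (a : L) : himp ⊥ a = ⊤ :=
  le_antisymm le_top (le_himp_iff.mpr (by rw [tens_bot]; exact bot_le))

lemma tens_iSup {ι : Sort w} (a : L) (f : ι → L) :
    tens a (⨆ i, f i) = ⨆ i, tens a (f i) := by
  rw [iSup, tens_sSup, iSup_range]

lemma himp_iSup_left {ι : Sort w} (f : ι → L) (c : L) :
    himp (⨆ i, f i) c = ⨅ i, himp (f i) c := by
  apply le_antisymm
  · exact le_iInf fun i => himp_le_himp_left c (le_iSup f i)
  · apply le_himp_iff.mpr
    rw [tens_iSup]
    apply iSup_le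
    intro i
    exact le_trans (tens_mono_left _ (iInf_le _ i)) (tens_himp_le _ _)

/-! ### L-subsets -/

/-- The fuzzy inclusion order on `L`-subsets. -/
def fsub {X : Type v} (A B : X → L) : L := ⨅ x, himp (A x) (B x)

/-- A nonempty `L`-subset. -/
def NonemptyL {X : Type v} (A : X → L) : Prop := (⨆ x, A x) = ⊤

/-- A finite `L`-subset. -/
def FinL {X : Type v} (F : X → L) : Prop :=
  ∀ D : Set (X → L), D.Nonempty → DirectedOn (· ≤ ·) D →
    fsub F (sSup D) = ⨆ A ∈ D, fsub F A

open Classical in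
/-- Characteristic function of a crisp subset. -/
noncomputable def chi {X : Type v} (Z : Set X) : X → L :=
  fun x => if x ∈ Z then ⊤ else ⊥

/-- Characteristic function of a point. -/
noncomputable def single {X : Type v} (x : X) : X → L := chi {x}

/-! ### L-convex structures -/

/-- A (stratified) `L`-convex structure on `X`. -/
def IsConvexStruct {X : Type v} (𝒞 : Set (X → L)) : Prop :=
  (fun _ => (⊥ : L)) ∈ 𝒞 ∧ (fun _ => (⊤ : L)) ∈ 𝒞 ∧
  (∀ D ⊆ 𝒞, D.Nonempty → DirectedOn (· ≤ ·) D → sSup D ∈ 𝒞) ∧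
  (∀ D ⊆ 𝒞, sInf D ∈ 𝒞) ∧
  (∀ (a : L), ∀ C ∈ 𝒞, (fun x => himp a (C x)) ∈ 𝒞)

/-- The hull operator of an `L`-convex structure. -/
def hull {X : Type v} (𝒞 : Set (X → L)) (A : X → L) : X → L :=
  sInf {B | B ∈ 𝒞 ∧ A ≤ B}

/-- Sobriety of an `L`-convex space. -/
def Sober {X : Type v} (𝒞 : Set (X → L)) : Prop :=
  ∀ F : X → L, NonemptyL F → FinL F → ∃! x : X, hull 𝒞 F = hull 𝒞 (single x)

/-- Compact (algebraic irreducible) convex sets. -/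
def IsCompactConvex {X : Type v} (𝒞 : Set (X → L)) (K : X → L) : Prop :=
  K ∈ 𝒞 ∧ NonemptyL K ∧
  ∀ D ⊆ 𝒞, D.Nonempty → DirectedOn (· ≤ ·) D →
    fsub K (sSup D) = ⨆ C ∈ D, fsub K C

/-- Convexity-preserving maps. -/
def ConvPres {X : Type v} {Y : Type w} (𝒞X : Set (X → L)) (𝒞Y : Set (Y → L))
    (f : X → Y) : Prop :=
  ∀ B ∈ 𝒞Y, (B ∘ f) ∈ 𝒞X

/-- The Zadeh (forward) extension of a map. -/
def zimg {X : Type v} {Y : Type w} (f : X → Y) (A : X → L) : Y → L :=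
  fun y => ⨆ x ∈ {x | f x = y}, A x

/-- Convex-to-convex maps. -/
def ConvToConv {X : Type v} {Y : Type w} (𝒞X : Set (X → L)) (𝒞Y : Set (Y → L))
    (f : X → Y) : Prop :=
  ∀ A ∈ 𝒞X, zimg f A ∈ 𝒞Y

/-- F-closed crisp subsets of an `L`-convex space. -/
def FClosed {X : Type v} (𝒞 : Set (X → L)) (A : Set X) : Prop :=
  ∀ F : X → L, NonemptyL F → FinL F → F ≤ chi A →
    ∀ x : X, hull 𝒞 F = hull 𝒞 (single x) → x ∈ A

/-- F-closure of a crisp subset. -/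
def fcl {X : Type v} (𝒞 : Set (X → L)) (Z : Set X) : Set X :=
  ⋂₀ {A : Set X | FClosed 𝒞 A ∧ Z ⊆ A}

/-- The `S₀` separation axiom. -/
def S0 {X : Type v} (𝒞 : Set (X → L)) : Prop :=
  ∀ x y : X, hull 𝒞 (single x) = hull 𝒞 (single y) → x = y

/-- The set of compact convex sets, as a type. -/
abbrev cpT {X : Type v} (𝒞 : Set (X → L)) : Type _ :=
  {K : X → L // IsCompactConvex 𝒞 K}

/-- `φ(A)(K) = sub(K, A)`. -/
def phi {X : Type v} (𝒞 : Set (X → L)) (A : X → L) : cpT 𝒞 → L :=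
  fun K => fsub K.1 A

/-- The convex structure `{φ(A) | A ∈ 𝒞}` on `cp(𝒞)`. -/
def cpStruct {X : Type v} (𝒞 : Set (X → L)) : Set (cpT 𝒞 → L) :=
  {Φ | ∃ A ∈ 𝒞, Φ = phi 𝒞 A}

/-- `Θ(X) = {co(1ₓ) | x ∈ X}` as a subset of `cp(𝒞)`. -/
def Theta {X : Type v} (𝒞 : Set (X → L)) : Set (cpT 𝒞) :=
  {K | ∃ x : X, (K : X → L) = hull 𝒞 (single x)}

/-- `X^F`: the F-closure of `Θ(X)` in `Cp(𝒞)`. -/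
def XF {X : Type v} (𝒞 : Set (X → L)) : Set (cpT 𝒞) :=
  fcl (cpStruct 𝒞) (Theta 𝒞)

/-- `X^F` as a type. -/
abbrev XFT {X : Type v} (𝒞 : Set (X → L)) : Type _ :=
  {K : cpT 𝒞 // K ∈ XF 𝒞}

/-- The restriction `φ(A)|_{X^F}`. -/
def phiF {X : Type v} (𝒞 : Set (X → L)) (A : X → L) : XFT 𝒞 → L :=
  fun K => fsub K.1.1 A

/-- The convex structure `{φ(A)|_{X^F} | A ∈ 𝒞}` on `X^F`. -/
def xfStruct {X : Type v} (𝒞 : Set (X → L)) : Set (XFT 𝒞 → L) :=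
  {Φ | ∃ A ∈ 𝒞, Φ = phiF 𝒞 A}

/-- The specialization `L`-order of an `L`-convex space. -/
def specOrd {X : Type v} (𝒞 : Set (X → L)) (x y : X) : L :=
  ⨅ A ∈ 𝒞, himp (A y) (A x)

/-! ### basic lemmas -/

lemma single_apply_self {X : Type v} (x : X) : (single x : X → L) x = ⊤ := by
  simp [single, chi]

lemma le_hull {X : Type v} (𝒞 : Set (X → L)) (A : X → L) : A ≤ hull 𝒞 A :=
  le_sInf fun B hB => hB.2

lemma hull_mem {X : Type v} {𝒞 : Set (X → L)} (hC : IsConvexStruct 𝒞)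
    (A : X → L) : hull 𝒞 A ∈ 𝒞 :=
  hC.2.2.2.1 _ fun B hB => hB.1

lemma fsub_anti_left {X : Type v} {A B : X → L} (C : X → L) (h : A ≤ B) :
    fsub B C ≤ fsub A C :=
  le_iInf fun x => le_trans (iInf_le _ x) (himp_le_himp_left _ (h x))

lemma fsub_mono_right {X : Type v} (A : X → L) {B C : X → L} (h : B ≤ C) :
    fsub A B ≤ fsub A C :=
  le_iInf fun x => le_trans (iInf_le _ x) (himp_le_himp_right _ (h x))

lemma fsub_single {X : Type v} (x : X) (C : X → L) :
    fsub (single x) C = C x := by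
  apply le_antisymm
  · refine le_trans (iInf_le _ x) ?_
    rw [single_apply_self, top_himp]
  · apply le_iInf
    intro y
    by_cases h : y = x
    · subst h
      rw [single_apply_self, top_himp]
    · have hy : (single x : X → L) y = ⊥ := by simp [single, chi, h]
      rw [hy, bot_himp]
      exact le_top

lemma sSup_apply_mem {X : Type v} (D : Set (X → L)) (x : X) :
    sSup D x = ⨆ A ∈ D, A x := by
  rw [sSup_apply]
  apply le_antisymm
  · exact iSup_le fun f => le_biSup (fun A => A x) f.2
  · exact iSup₂_le fun A hA => le_iSup_of_le ⟨A, hA⟩ le_rfl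

lemma fsub_hull {X : Type v} {𝒞 : Set (X → L)} (hC : IsConvexStruct 𝒞)
    (A : X → L) {B : X → L} (hB : B ∈ 𝒞) :
    fsub (hull 𝒞 A) B = fsub A B := by
  apply le_antisymm
  · exact fsub_anti_left _ (le_hull 𝒞 A)
  · set s := fsub A B with hs
    have hmem : (fun x => himp s (B x)) ∈ 𝒞 := hC.2.2.2.2 s B hB
    have hA : A ≤ fun x => himp s (B x) := by
      intro x
      have h1 : s ≤ himp (A x) (B x) := iInf_le _ x
      have h2 : tens s (A x) ≤ B x := le_himp_iff.mp h1
      have h3 : tens (A x) s ≤ B x := by rwa [tens_comm]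
      exact le_himp_iff.mpr h3
    have hle : hull 𝒞 A ≤ fun x => himp s (B x) := sInf_le ⟨hmem, hA⟩
    apply le_iInf
    intro x
    have h5 : tens (hull 𝒞 A x) s ≤ B x := le_himp_iff.mp (hle x)
    have h4 : tens s (hull 𝒞 A x) ≤ B x := by rwa [tens_comm]
    exact le_himp_iff.mpr h4

lemma hull_single_compact {X : Type v} {𝒞 : Set (X → L)}
    (hC : IsConvexStruct 𝒞) (x : X) :
    IsCompactConvex 𝒞 (hull 𝒞 (single x)) := by
  refine ⟨hull_mem hC _, ?_, ?_⟩
  · apply le_antisymm le_top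
    calc (⊤ : L) = single x x := (single_apply_self x).symm
      _ ≤ hull 𝒞 (single x) x := le_hull 𝒞 _ x
      _ ≤ ⨆ y, hull 𝒞 (single x) y := le_iSup _ x
  · intro D hD hne hdir
    rw [fsub_hull hC _ (hC.2.2.1 D hD hne hdir), fsub_single, sSup_apply_mem]
    apply le_antisymm
    · refine iSup₂_le fun A hA => ?_
      have : fsub (hull 𝒞 (single x)) A = A x := by
        rw [fsub_hull hC _ (hD hA), fsub_single]
      exact le_trans (le_of_eq this.symm) (le_biSup _ hA)
    · refine iSup₂_le fun A hA => ?_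
      have : fsub (hull 𝒞 (single x)) A = A x := by
        rw [fsub_hull hC _ (hD hA), fsub_single]
      rw [this]
      exact le_biSup (fun A => A x) hA

/-- `Θ(X) ⊆ X^F`. -/
lemma Theta_subset_XF {X : Type v} (𝒞 : Set (X → L)) : Theta 𝒞 ⊆ XF 𝒞 :=
  fun K hK => Set.mem_sInter.mpr fun _ hA => hA.2 hK

/-- The canonical map `ξ_X : X → X^F`, `ξ_X(x) = co(1ₓ)`. -/
noncomputable def xi {X : Type v} {𝒞 : Set (X → L)} (hC : IsConvexStruct 𝒞)
    (x : X) : XFT 𝒞 :=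
  ⟨⟨hull 𝒞 (single x), hull_single_compact hC x⟩, Theta_subset_XF 𝒞 ⟨x, rfl⟩⟩

/-! ### L-orders -/

/-- An `L`-order. -/
structure IsLOrder {P : Type v} (e : P → P → L) : Prop where
  refl : ∀ x, e x x = ⊤
  trans : ∀ x y z, tens (e x y) (e y z) ≤ e x z
  antisymm : ∀ x y, e x y ⊓ e y x = ⊤ → x = y

/-- Lower `L`-subsets. -/
def LowerL {P : Type v} (e : P → P → L) (S : P → L) : Prop :=
  ∀ x y, tens (S x) (e y x) ≤ S y

/-- `s` is the supremum of the `L`-subset `A`. -/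
def IsSupL {P : Type v} (e : P → P → L) (A : P → L) (s : P) : Prop :=
  ∀ y, e s y = fsub A (fun z => e z y)

/-- Scott convex `L`-subsets. -/
def ScottConvex {P : Type v} (e : P → P → L) (A : P → L) : Prop :=
  LowerL e A ∧
  ∀ F : P → L, NonemptyL F → FinL F → ∀ s, IsSupL e F s → fsub F A ≤ A s

/-- The Scott `L`-convex structure `σ*(P)`. -/
def scottStruct {P : Type v} (e : P → P → L) : Set (P → L) :=
  {A | ScottConvex e A}

/-- `L`-join-semilattices. -/
def LJoinSemilat {P : Type v} (e : P → P → L) : Prop :=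
  ∀ F : P → L, NonemptyL F → FinL F → ∃ s, IsSupL e F s

/-- `L`-order-preserving maps. -/
def OrdPres {P : Type v} {Q : Type w} (eP : P → P → L) (eQ : Q → Q → L)
    (f : P → Q) : Prop :=
  ∀ x y, eP x y ≤ eQ (f x) (f y)

/-- Scott convexity-preserving maps. -/
def ScottCP {P : Type v} {Q : Type w} (eP : P → P → L) (eQ : Q → Q → L)
    (f : P → Q) : Prop :=
  OrdPres eP eQ f ∧
  ∀ F : P → L, NonemptyL F → FinL F →
    ∀ s, IsSupL eP F s → IsSupL eQ (zimg f F) (f s)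

/-- Sobrification of an `L`-convex space. -/
def IsSobrification {X : Type v} {Y : Type w} (𝒞X : Set (X → L))
    (𝒞Y : Set (Y → L)) (j : X → Y) : Prop :=
  IsConvexStruct 𝒞Y ∧ Sober 𝒞Y ∧ ConvPres 𝒞X 𝒞Y j ∧
  ∀ (Z : Type u') (𝒞Z : Set (Z → L)), IsConvexStruct 𝒞Z → Sober 𝒞Z →
    ∀ f : X → Z, ConvPres 𝒞X 𝒞Z f →
      ∃! g : Y → Z, ConvPres 𝒞Y 𝒞Z g ∧ f = g ∘ j

/-- `L`-join-semilattice completion. -/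
def IsLJSCompletion {P : Type v} {Q : Type w} (eP : P → P → L)
    (eQ : Q → Q → L) (j : P → Q) : Prop :=
  IsLOrder eQ ∧ LJoinSemilat eQ ∧ ScottCP eP eQ j ∧
  ∀ (M : Type u') (eM : M → M → L), IsLOrder eM → LJoinSemilat eM →
    ∀ f : P → M, ScottCP eP eM f →
      ∃! g : Q → M, ScottCP eQ eM g ∧ f = g ∘ j

/-- `σ*(P)` is an `L`-convex structure. -/
lemma scottStruct_isConvexStruct {P : Type v} (e : P → P → L) :
    IsConvexStruct (scottStruct e) := by
  refine ⟨⟨?_, ?_⟩, ⟨?_, ?_⟩, ?_, ?_, ?_⟩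
  · intro x y
    rw [tens_comm, tens_bot]
  · intro F hF _ s _
    have h1 : fsub F (fun _ => (⊥ : L)) = himp (⨆ x, F x) ⊥ := by
      rw [himp_iSup_left]; rfl
    rw [h1, hF, top_himp]
  · intro x y
    exact le_top
  · intro F _ _ s _
    exact le_top
  · -- directed joins
    intro D hD hne hdir
    constructor
    · intro x y
      apply le_himp_iff.mp
      rw [sSup_apply_mem]
      refine iSup₂_le fun A hA => le_himp_iff.mpr ?_
      exact le_trans ((hD hA).1 x y) (by rw [sSup_apply_mem]; exact le_biSup (fun A => A y) hA)
    · intro F hF hFin s hs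
      rw [hFin D hne hdir, sSup_apply_mem]
      exact iSup₂_le fun A hA =>
        le_trans ((hD hA).2 F hF hFin s hs) (le_biSup (fun A => A s) hA)
  · -- arbitrary meets
    intro D hD
    constructor
    · intro x y
      rw [sInf_apply, sInf_apply]
      apply le_iInf
      intro A
      exact le_trans (tens_mono_left _ (iInf_le _ A)) ((hD A.2).1 x y)
    · intro F hF hFin s hs
      rw [sInf_apply]
      apply le_iInf
      intro A
      refine le_trans (fsub_mono_right F ?_) ((hD A.2).2 F hF hFin s hs)
      intro x
      rw [sInf_apply]
      exact iInf_le _ A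
  · -- himp closure
    intro a C hC
    constructor
    · intro x y
      apply le_himp_iff.mpr
      have h1 : tens (tens (himp a (C x)) (e y x)) a
          = tens (tens (himp a (C x)) a) (e y x) := by
        rw [tens_assoc, tens_comm (e y x) a, ← tens_assoc]
      rw [h1]
      exact le_trans (tens_mono_left _ (tens_himp_le a (C x))) (hC.1 x y)
    · intro F hF hFin s hs
      apply le_himp_iff.mpr
      refine le_trans ?_ (hC.2 F hF hFin s hs)
      apply le_iInf
      intro x
      apply le_himp_iff.mpr
      have h1 : tens (tens (fsub F (fun x => himp a (C x))) a) (F x)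
          = tens (tens (fsub F (fun x => himp a (C x))) (F x)) a := by
        rw [tens_assoc, tens_comm a (F x), ← tens_assoc]
      rw [h1]
      have h2 : tens (fsub F (fun x => himp a (C x))) (F x) ≤ himp a (C x) :=
        le_trans (tens_mono_left _ (iInf_le _ x)) (tens_himp_le _ _)
      exact le_trans (tens_mono_left _ h2) (tens_himp_le a (C x))

end CRL

namespace CRL

variable {L : Type u} [CRL L]

lemma himp_tens (a b c : L) : himp (tens a b) c = himp a (himp b c) :=
  eq_of_forall_le_iff fun d => by
    rw [le_himp_iff, le_himp_iff, le_himp_iff, tens_assoc]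

lemma himp_iInf_right {ι : Sort w} (a : L) (f : ι → L) :
    himp a (⨅ i, f i) = ⨅ i, himp a (f i) :=
  eq_of_forall_le_iff fun d => by
    simp only [le_himp_iff, le_iInf_iff]

lemma himp_eq_top_iff {a b : L} : himp a b = ⊤ ↔ a ≤ b := by
  rw [← top_le_iff, le_himp_iff, tens_comm, tens_top]

lemma fsub_eq_top_iff {X : Type v} {A B : X → L} : fsub A B = ⊤ ↔ A ≤ B := by
  simp only [fsub, iInf_eq_top, himp_eq_top_iff, Pi.le_def]

lemma single_le_iff {X : Type v} {x : X} {B : X → L} : single x ≤ B ↔ B x = ⊤ := by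
  rw [← fsub_eq_top_iff, fsub_single]

lemma hull_le_iff {X : Type v} {𝒞 : Set (X → L)} {A B : X → L} (hB : B ∈ 𝒞) :
    hull 𝒞 A ≤ B ↔ A ≤ B :=
  ⟨(le_hull 𝒞 A).trans, fun h => sInf_le ⟨hB, h⟩⟩

lemma hull_eq_hull_iff {X : Type v} {𝒞 : Set (X → L)} {A A' : X → L} :
    hull 𝒞 A = hull 𝒞 A' ↔ ∀ B ∈ 𝒞, A ≤ B ↔ A' ≤ B := by
  constructor
  · intro h B hB
    rw [← hull_le_iff hB, h, hull_le_iff hB]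
  · intro h
    unfold hull
    congr 1
    ext B
    exact and_congr_right (h B)

/-- An `L`-subset has the same hull as a point as soon as both are sent to the same value
by every convex set. -/
lemma hull_eq_hull_single {X : Type v} {𝒞 : Set (X → L)} {F : X → L} {x : X}
    (h : ∀ B ∈ 𝒞, fsub F B = B x) : hull 𝒞 F = hull 𝒞 (single x) :=
  hull_eq_hull_iff.mpr fun B hB => by
    rw [← fsub_eq_top_iff, h B hB, single_le_iff]

/-- Extension of an `L`-subset of a crisp subset by `⊥`. -/
def extend {X : Type v} {Z : Set X} (F : Z → L) : X → L :=
  fun x => ⨆ h : x ∈ Z, F ⟨x, h⟩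

lemma fsub_extend {X : Type v} {Z : Set X} (F : Z → L) (B : X → L) :
    fsub (extend F) B = fsub F fun z => B z := by
  simp only [fsub, extend, himp_iSup_left, iInf_subtype]

lemma NonemptyL.extend {X : Type v} {Z : Set X} {F : Z → L} (hF : NonemptyL F) :
    NonemptyL (extend F) := by
  rw [NonemptyL, iSup_subtype] at hF
  exact hF

lemma extend_le_chi {X : Type v} {Z : Set X} (F : Z → L) : extend F ≤ chi Z := by
  intro x
  refine iSup_le fun h => ?_
  simp [chi, h]

lemma FinL.extend {X : Type v} {Z : Set X} {F : Z → L} (hF : FinL F) :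
    FinL (extend F) := by
  intro D hne hdir
  let r : (X → L) → Z → L := fun B z => B z
  have hr : Monotone r := fun _ _ h z => h z
  have h := hF (r '' D) (hne.image r) (hdir.mono_comp hr)
  have hsup : (fun z : Z => sSup D z) = sSup (r '' D) := by
    funext z
    rw [sSup_apply_mem, sSup_apply_mem, iSup_image]
  rw [fsub_extend, hsup, h, iSup_image]
  simp only [fsub_extend, r]

/-- The join of a family of `L`-subsets weighted by `F`. -/
def wsup {X : Type v} {ι : Type w} (F : ι → L) (k : ι → X → L) : X → L :=
  fun x => ⨆ i, tens (F i) (k i x)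

lemma fsub_wsup {X : Type v} {ι : Type w} (F : ι → L) (k : ι → X → L) (A : X → L) :
    fsub (wsup F k) A = fsub F fun i => fsub (k i) A := by
  simp only [fsub, wsup, himp_iSup_left, himp_iInf_right, himp_tens]
  exact iInf_comm

lemma NonemptyL.wsup {X : Type v} {ι : Type w} {F : ι → L} {k : ι → X → L}
    (hF : NonemptyL F) (hk : ∀ i, NonemptyL (k i)) : NonemptyL (wsup F k) := by
  have h : ∀ i, ⨆ x, tens (F i) (k i x) = F i := fun i => by
    rw [← tens_iSup, hk i, tens_top]
  unfold NonemptyL CRL.wsup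
  rw [iSup_comm]
  simp only [h]
  exact hF

/-- The hull of the join of a finite nonempty `L`-subset of compact convex sets is compact. -/
lemma isCompactConvex_hull_wsup {X : Type v} {𝒞 : Set (X → L)} (hC : IsConvexStruct 𝒞)
    {F : cpT 𝒞 → L} (hne : NonemptyL F) (hfin : FinL F) :
    IsCompactConvex 𝒞 (hull 𝒞 (wsup F Subtype.val)) := by
  refine ⟨hull_mem hC _, ?_, ?_⟩
  · have h : NonemptyL (wsup F Subtype.val) := hne.wsup fun K => K.2.2.1
    exact top_le_iff.mp (h.ge.trans (iSup_mono (le_hull 𝒞 _)))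
  · intro D hD hDne hdir
    have key : ∀ A ∈ 𝒞, fsub (hull 𝒞 (wsup F Subtype.val)) A = fsub F (phi 𝒞 A) :=
      fun A hA => by rw [fsub_hull hC _ hA, fsub_wsup]; rfl
    have hmono : Monotone (phi 𝒞) := fun _ _ h K => fsub_mono_right _ h
    have hsup : phi 𝒞 (sSup D) = sSup (phi 𝒞 '' D) := by
      funext K
      rw [sSup_apply_mem, iSup_image]
      exact K.2.2.2 D hD hDne hdir
    rw [key _ (hC.2.2.1 D hD hDne hdir), hsup,
      hfin _ (hDne.image _) (hdir.mono_comp hmono), iSup_image]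
    exact biSup_congr fun A hA => (key A (hD hA)).symm

lemma fClosed_fcl {X : Type v} (𝒞 : Set (X → L)) (Z : Set X) : FClosed 𝒞 (fcl 𝒞 Z) := by
  intro F hne hfin hF x hx
  refine Set.mem_sInter.mpr fun A hA => hA.1 F hne hfin (hF.trans fun y => ?_) x hx
  by_cases hy : y ∈ fcl 𝒞 Z
  · have hyA : y ∈ A := Set.mem_sInter.mp hy A hA
    simp [chi, hyA]
  · simp [chi, hy]

end CRL

open CRL in
/-- `X^F` is a sober `L`-convex space. -/
theorem stmt_7 {L : Type u} [CRL L] {X : Type v} {𝒞 : Set (X → L)}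
    (hC : IsConvexStruct 𝒞) :
    Sober (xfStruct 𝒞) := by
  intro F hne hfin
  let K : cpT 𝒞 := ⟨_, isCompactConvex_hull_wsup hC hne.extend hfin.extend⟩
  have hK : ∀ A ∈ 𝒞, fsub (extend F) (phi 𝒞 A) = phi 𝒞 A K := fun A hA =>
    ((fsub_hull hC _ hA).trans (fsub_wsup _ _ _)).symm
  have hKmem : K ∈ XF 𝒞 := by
    refine fClosed_fcl _ _ _ hne.extend hfin.extend (extend_le_chi F) K
      (hull_eq_hull_single ?_)
    rintro _ ⟨A, hA, rfl⟩
    exact hK A hA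
  have hhull : hull (xfStruct 𝒞) F = hull (xfStruct 𝒞) (single ⟨K, hKmem⟩) := by
    refine hull_eq_hull_single ?_
    rintro _ ⟨A, hA, rfl⟩
    exact (fsub_extend F (phi 𝒞 A)).symm.trans (hK A hA)
  refine ⟨⟨K, hKmem⟩, hhull, fun K' hK' => ?_⟩
  have h : ∀ A ∈ 𝒞, K'.1.1 ≤ A ↔ K.1 ≤ A := fun A hA => by
    have := hull_eq_hull_iff.mp (hK'.symm.trans hhull) _ ⟨A, hA, rfl⟩
    rwa [single_le_iff, single_le_iff, phiF, phiF, fsub_eq_top_iff, fsub_eq_top_iff] at this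
  exact Subtype.ext (Subtype.ext (le_antisymm ((h _ K.2.1).mpr le_rfl)
    ((h _ K'.1.2.1).mp le_rfl)))
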